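/- Let H be a real inner product space, let c ∈ (0,1), and let δ, C̄ be real numbers with 0 < δ ≤ C̄. Then there do not exist sequences (ξ_k) and (η_k) in H such that for every k ∈ ℕ: ‖ξ_k‖ ≤ C̄, ‖η_k‖ ≤ C̄, ‖ξ_k‖ > δ, ⟨η_k, ξ_k⟩ ≤ c‖ξ_k‖², and ‖ξ_{k+1}‖ ≤ ‖t η_k + (1 - t) ξ_k‖ for all t ∈ [0,1]. -/

import Mathlib

open scoped RealInnerProductSpace

theorem norm_sq_convex_combination_le {H : Type*} [NormedAddCommGroup H] [InnerProductSpace ℝ H]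
    {c C t : ℝ} (hc : 0 ≤ c) {x y : H} (hx : ‖x‖ ≤ C) (hy : ‖y‖ ≤ C)
    (hxy : ⟪y, x⟫ ≤ c * ‖x‖ ^ 2) (ht : t ∈ Set.Icc (0 : ℝ) 1) :
    ‖t • y + (1 - t) • x‖ ^ 2 ≤ ‖x‖ ^ 2 - 2 * t * (1 - c) * ‖x‖ ^ 2 + 2 * t ^ 2 * C ^ 2 := by
  obtain ⟨ht0, ht1⟩ := ht
  have hx2 : ‖x‖ ^ 2 ≤ C ^ 2 := by gcongr
  have hy2 : ‖y‖ ^ 2 ≤ C ^ 2 := by gcongr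
  have expand : ‖t • y + (1 - t) • x‖ ^ 2 =
      t ^ 2 * ‖y‖ ^ 2 + 2 * (t * (1 - t)) * ⟪y, x⟫ + (1 - t) ^ 2 * ‖x‖ ^ 2 := by
    rw [norm_add_sq_real, real_inner_smul_left, real_inner_smul_right, norm_smul, norm_smul,
      mul_pow, mul_pow, Real.norm_eq_abs, Real.norm_eq_abs, sq_abs, sq_abs]
    ring
  have h₁ := mul_le_mul_of_nonneg_left hxy (mul_nonneg ht0 (sub_nonneg.2 ht1))
  have h₂ := mul_le_mul_of_nonneg_left hy2 (sq_nonneg t)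
  have h₃ := mul_le_mul_of_nonneg_left hx2 (sq_nonneg t)
  have h₄ : 0 ≤ t ^ 2 * (c * ‖x‖ ^ 2) := by positivity
  rw [expand]
  linarith

theorem stmt_11 {H : Type*} [NormedAddCommGroup H] [InnerProductSpace ℝ H]
    (c : ℝ) (hc : c ∈ Set.Ioo (0 : ℝ) 1)
    (δ Cbar : ℝ) (hδ : 0 < δ) (hδC : δ ≤ Cbar) :
    ¬ ∃ ξ η : ℕ → H, ∀ k : ℕ,
      ‖ξ k‖ ≤ Cbar ∧ ‖η k‖ ≤ Cbar ∧ δ < ‖ξ k‖ ∧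
      ⟪η k, ξ k⟫ ≤ c * ‖ξ k‖ ^ 2 ∧
      ∀ t ∈ Set.Icc (0 : ℝ) 1, ‖ξ (k + 1)‖ ≤ ‖t • η k + (1 - t) • ξ k‖ := by
  rintro ⟨ξ, η, h⟩
  obtain ⟨hc0, hc1⟩ := hc
  have hC : 0 < Cbar := hδ.trans_le hδC
  have hc' : 0 < 1 - c := sub_pos.2 hc1
  have hδC2 : δ ^ 2 ≤ Cbar ^ 2 := by gcongr
  obtain ⟨t, ht⟩ : ∃ t, t = (1 - c) * δ ^ 2 / (2 * Cbar ^ 2) := ⟨_, rfl⟩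
  have htC : 2 * t * Cbar ^ 2 = (1 - c) * δ ^ 2 := by
    rw [ht]
    field_simp
  have ht0 : 0 < t := by
    rw [ht]
    positivity
  have ht1 : t ≤ 1 := by
    rw [ht, div_le_one (by positivity)]
    nlinarith [sq_nonneg δ]
  have step (k : ℕ) : ‖ξ (k + 1)‖ ^ 2 ≤ ‖ξ k‖ ^ 2 - t * (1 - c) * δ ^ 2 := by
    obtain ⟨hξ, hη, hδξ, hin, hmin⟩ := h k
    have htmem : t ∈ Set.Icc (0 : ℝ) 1 := ⟨ht0.le, ht1⟩
    have h₁ : ‖ξ (k + 1)‖ ^ 2 ≤ ‖t • η k + (1 - t) • ξ k‖ ^ 2 := by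
      gcongr
      exact hmin t htmem
    have h₂ := norm_sq_convex_combination_le hc0.le hξ hη hin htmem
    have h₃ : t * (1 - c) * δ ^ 2 ≤ t * (1 - c) * ‖ξ k‖ ^ 2 := by gcongr
    have h₄ : 2 * t ^ 2 * Cbar ^ 2 = t * (1 - c) * δ ^ 2 := by linear_combination t * htC
    linarith
  have bound (k : ℕ) : ‖ξ k‖ ^ 2 ≤ ‖ξ 0‖ ^ 2 - k * (t * (1 - c) * δ ^ 2) := by
    induction k with
    | zero => simp
    | succ k ih =>
      push_cast
      linarith [step k]
  have hε : 0 < t * (1 - c) * δ ^ 2 := by positivity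
  obtain ⟨n, hn⟩ := exists_nat_gt (‖ξ 0‖ ^ 2 / (t * (1 - c) * δ ^ 2))
  rw [div_lt_iff₀ hε] at hn
  linarith [bound n, sq_nonneg ‖ξ n‖]
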